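/- arXiv:2506.00834 — 8 statements merged into one kernel-verified Lean document; each statement's English description precedes it below -/
import Mathlib

section
/- Let m ∈ ℝ, let g : ℕ → ℝ with g(t) > 0 for all t, and for each flow i let x_i : ℕ → ℝ satisfy x_i(0) > 0 and x_i(t+1) = x_i(t) · (g(t) / x_i(t))^m. Then x_i(t) > 0 for all t, and for any two flows i, j and every t, ln(x_i(t) / x_j(t)) = (1 − m)^t · ln(x_i(0) / x_j(0)). -/
/-- Let `m ∈ ℝ`, let `g : ℕ → ℝ` be a positive signal, and for each
flow `i` let `x i : ℕ → ℝ` satisfy `x i 0 > 0` and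
`x i (t+1) = x i t * (g t / x i t) ^ m` (real power). Then `x i t > 0` for all
`i, t`, and for any two flows `i, j` and every `t`,
`ln (x i t / x j t) = (1 − m) ^ t * ln (x i 0 / x j 0)`. -/
theorem stmt_7 (m : ℝ) (g : ℕ → ℝ) (hg : ∀ t, 0 < g t)
    {ι : Type*} (x : ι → ℕ → ℝ)
    (hx0 : ∀ i, 0 < x i 0)
    (hrec : ∀ i t, x i (t + 1) = x i t * (g t / x i t) ^ m) :
    (∀ i t, 0 < x i t) ∧
      (∀ i j t, Real.log (x i t / x j t) =
        (1 - m) ^ t * Real.log (x i 0 / x j 0)) := by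
  have hpos : ∀ i t, 0 < x i t := by
    intro i t
    induction t with
    | zero => exact hx0 i
    | succ t ih =>
      rw [hrec]
      exact mul_pos ih (Real.rpow_pos_of_pos (div_pos (hg t) ih) m)
  have hlog : ∀ i t, Real.log (x i (t + 1)) =
      (1 - m) * Real.log (x i t) + m * Real.log (g t) := by
    intro i t
    have hq := div_pos (hg t) (hpos i t)
    rw [hrec, Real.log_mul (hpos i t).ne' (Real.rpow_pos_of_pos hq m).ne',
      Real.log_rpow hq, Real.log_div (hg t).ne' (hpos i t).ne']
    ring
  refine ⟨hpos, fun i j t => ?_⟩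
  induction t with
  | zero => simp
  | succ t ih =>
    rw [Real.log_div (hpos i t).ne' (hpos j t).ne'] at ih
    rw [Real.log_div (hpos i _).ne' (hpos j _).ne', hlog, hlog, pow_succ]
    linear_combination (1 - m) * ih
end

section
/- (Lemma: Convergence to Weighted Fairness.) Let m ∈ ℝ. The following are equivalent: (i) 0 < m < 2; (ii) for every positive signal g : ℕ → ℝ and every pair of sequences x, y : ℕ → ℝ with x(0) > 0, y(0) > 0, x(t+1) = x(t) · (g(t) / x(t))^m, and y(t+1) = y(t) · (g(t) / y(t))^m, the ratio x(t) / y(t) converges to 1 as t → ∞. -/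
/-- Iterates of the multiplicative update stay positive. -/
theorem pos_of_rpow_update {m : ℝ} {g x : ℕ → ℝ} (hg : ∀ t, 0 < g t) (hx0 : 0 < x 0)
    (hx : ∀ t, x (t + 1) = x t * (g t / x t) ^ m) (t : ℕ) : 0 < x t := by
  induction t with
  | zero => exact hx0
  | succ t ih =>
    rw [hx]
    exact mul_pos ih (Real.rpow_pos_of_pos (div_pos (hg t) ih) m)

/-- In logarithmic coordinates the multiplicative update is affine. -/
theorem log_rpow_update {m g x : ℝ} (hg : 0 < g) (hx : 0 < x) :
    Real.log (x * (g / x) ^ m) = (1 - m) * Real.log x + m * Real.log g := by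
  have hgx : 0 < g / x := div_pos hg hx
  rw [Real.log_mul hx.ne' (Real.rpow_pos_of_pos hgx m).ne', Real.log_rpow hgx,
    Real.log_div hg.ne' hx.ne']
  ring

/-- The log-difference of two flows driven by the same signal is geometric. -/
theorem log_sub_log_rpow_update {m : ℝ} {g x y : ℕ → ℝ} (hg : ∀ t, 0 < g t)
    (hx0 : 0 < x 0) (hy0 : 0 < y 0)
    (hx : ∀ t, x (t + 1) = x t * (g t / x t) ^ m)
    (hy : ∀ t, y (t + 1) = y t * (g t / y t) ^ m) (t : ℕ) :
    Real.log (x t) - Real.log (y t) =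
      (1 - m) ^ t * (Real.log (x 0) - Real.log (y 0)) := by
  induction t with
  | zero => simp
  | succ t ih =>
    rw [hx, hy, log_rpow_update (hg t) (pos_of_rpow_update hg hx0 hx t),
      log_rpow_update (hg t) (pos_of_rpow_update hg hy0 hy t), pow_succ]
    linear_combination (1 - m) * ih

/-- The powers of `1 - m` vanish in the limit exactly when `0 < m < 2`. -/
theorem tendsto_one_sub_pow_iff {m : ℝ} :
    Filter.Tendsto (fun t : ℕ => (1 - m) ^ t) Filter.atTop (nhds 0) ↔ 0 < m ∧ m < 2 := by
  rw [tendsto_pow_atTop_nhds_zero_iff, abs_lt]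
  constructor <;> rintro ⟨h₁, h₂⟩ <;> constructor <;> linarith

/-- Convergence to Weighted Fairness: For `m ∈ ℝ`, the condition
`0 < m < 2` holds iff for every positive signal `g : ℕ → ℝ` and every pair of
sequences `x, y : ℕ → ℝ` with `x 0 > 0`, `y 0 > 0`,
`x (t+1) = x t * (g t / x t) ^ m` and `y (t+1) = y t * (g t / y t) ^ m`
(real powers), the ratio `x t / y t` tends to `1` as `t → ∞`. -/
theorem stmt_8 (m : ℝ) :
    (0 < m ∧ m < 2) ↔
      ∀ (g x y : ℕ → ℝ), (∀ t, 0 < g t) → 0 < x 0 → 0 < y 0 →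
        (∀ t, x (t + 1) = x t * (g t / x t) ^ m) →
        (∀ t, y (t + 1) = y t * (g t / y t) ^ m) →
        Filter.Tendsto (fun t => x t / y t) Filter.atTop (nhds 1) := by
  rw [← tendsto_one_sub_pow_iff]
  constructor
  · intro h g x y hg hx0 hy0 hx hy
    have hlim : Filter.Tendsto
        (fun t => Real.exp ((1 - m) ^ t * (Real.log (x 0) - Real.log (y 0))))
        Filter.atTop (nhds 1) := by
      simpa using (h.mul_const (Real.log (x 0) - Real.log (y 0))).rexp
    refine hlim.congr fun t => ?_
    rw [← log_sub_log_rpow_update hg hx0 hy0 hx hy t, Real.exp_sub,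
      Real.exp_log (pos_of_rpow_update hg hx0 hx t),
      Real.exp_log (pos_of_rpow_update hg hy0 hy t)]
  · intro h
    have hlim := h (fun _ => 1) (fun t => Real.exp ((1 - m) ^ t)) (fun _ => 1)
      (fun _ => one_pos) (Real.exp_pos _) one_pos
      (fun t => by
        rw [one_div, ← Real.exp_neg, ← Real.exp_mul, ← Real.exp_add]
        congr 1
        ring)
      (fun t => by simp)
    simpa using hlim.log one_ne_zero
end

section
/- Let 0 < m < 2, let g : ℕ → ℝ be positive with g(t) → L as t → ∞ for some L > 0, and let x : ℕ → ℝ satisfy x(0) > 0 and x(t+1) = x(t) · (g(t) / x(t))^m. Then x(t) → L as t → ∞. -/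
/-- A scalar linear recurrence with contraction factor `|c| < 1` and vanishing forcing term
converges to zero. -/
theorem tendsto_zero_of_linear_recurrence {c : ℝ} (hc : |c| < 1) {a b : ℕ → ℝ}
    (hb : Filter.Tendsto b Filter.atTop (nhds 0)) (ha : ∀ t, a (t + 1) = c * a t + b t) :
    Filter.Tendsto a Filter.atTop (nhds 0) := by
  rw [Metric.tendsto_atTop]
  intro ε hε
  have hδ : 0 < (1 - |c|) * (ε / 2) := mul_pos (sub_pos.2 hc) (half_pos hε)
  obtain ⟨N, hN⟩ := Metric.tendsto_atTop.1 hb _ hδ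
  have hbound : ∀ k, |a (N + k)| ≤ |c| ^ k * |a N| + ε / 2 := by
    intro k
    induction k with
    | zero => simpa using (half_pos hε).le
    | succ k ih =>
      have hbk : |b (N + k)| < (1 - |c|) * (ε / 2) := by
        simpa using hN (N + k) (Nat.le_add_right N k)
      calc |a (N + (k + 1))| = |c * a (N + k) + b (N + k)| := by rw [← add_assoc, ha]
        _ ≤ |c| * |a (N + k)| + |b (N + k)| := by
          rw [← abs_mul]
          exact abs_add_le _ _
        _ ≤ |c| * (|c| ^ k * |a N| + ε / 2) + (1 - |c|) * (ε / 2) := by gcongr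
        _ = |c| ^ (k + 1) * |a N| + ε / 2 := by ring
  have hpow : Filter.Tendsto (fun k : ℕ => |c| ^ k * |a N|) Filter.atTop (nhds 0) := by
    simpa using (tendsto_pow_atTop_nhds_zero_of_lt_one (abs_nonneg c) hc).mul_const |a N|
  obtain ⟨K, hK⟩ := Filter.eventually_atTop.1 (hpow.eventually_lt_const (half_pos hε))
  refine ⟨N + K, fun n hn => ?_⟩
  obtain ⟨k, rfl⟩ := Nat.exists_eq_add_of_le (le_trans (Nat.le_add_right N K) hn)
  have h₁ := hbound k
  have h₂ := hK k (by omega)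
  rw [Real.dist_eq, sub_zero]
  linarith


/-- Let `0 < m < 2`, let `g : ℕ → ℝ` be positive with `g t → L`
for some `L > 0`, and let `x : ℕ → ℝ` satisfy `x 0 > 0` and
`x (t+1) = x t * (g t / x t) ^ m` (real power). Then `x t → L` as `t → ∞`. -/
theorem stmt_11 (m : ℝ) (hm0 : 0 < m) (hm2 : m < 2) (g x : ℕ → ℝ) (L : ℝ)
    (hg : ∀ t, 0 < g t) (hL : 0 < L)
    (hgL : Filter.Tendsto g Filter.atTop (nhds L))
    (hx0 : 0 < x 0) (hrec : ∀ t, x (t + 1) = x t * (g t / x t) ^ m) :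
    Filter.Tendsto x Filter.atTop (nhds L) := by
  have hx : ∀ t, 0 < x t := by
    intro t
    induction t with
    | zero => exact hx0
    | succ t ih =>
      rw [hrec]
      exact mul_pos ih (Real.rpow_pos_of_pos (div_pos (hg t) ih) m)
  have hforcing : Filter.Tendsto (fun t => m * (Real.log (g t) - Real.log L))
      Filter.atTop (nhds 0) := by
    simpa using ((hgL.log hL.ne').sub_const (Real.log L)).const_mul m
  have hlog : Filter.Tendsto (fun t => Real.log (x t) - Real.log L) Filter.atTop (nhds 0) := by
    refine tendsto_zero_of_linear_recurrence (c := 1 - m)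
      (abs_lt.2 ⟨by linarith, by linarith⟩) hforcing fun t => ?_
    have hratio : 0 < g t / x t := div_pos (hg t) (hx t)
    rw [hrec, Real.log_mul (hx t).ne' (Real.rpow_pos_of_pos hratio m).ne',
      Real.log_rpow hratio, Real.log_div (hg t).ne' (hx t).ne']
    ring
  have hexp := (Real.continuous_exp.tendsto _).comp (hlog.add_const (Real.log L))
  simpa [Function.comp_def, Real.exp_log, hx, hL] using hexp
end

section
/- Let 0 < m < 2, let w_0, …, w_n > 0 with W = w_0 + ⋯ + w_n, let B > 0, and suppose the observed delay signal satisfies T⁻¹(D(t)) → B / W as t → ∞ (with T⁻¹(D(t)) > 0 for all t). If each flow's rate satisfies r_i(0) > 0 and r_i(t+1) = r_i(t) · (T⁻¹(D(t)) / (r_i(t)/w_i))^m, then for every flow i, r_i(t) → (w_i / W) · B as t → ∞; i.e., the rates converge to the weighted bandwidth allocation of Equation (1). -/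
/-- A linear recursion with contraction factor `|c| < 1`, driven by a null sequence, tends to `0`. -/
theorem tendsto_zero_of_linear_recursion {c : ℝ} (hc : |c| < 1) {x e : ℕ → ℝ}
    (he : Filter.Tendsto e Filter.atTop (nhds 0)) (hx : ∀ t, x (t + 1) = c * x t + e t) :
    Filter.Tendsto x Filter.atTop (nhds 0) := by
  rw [Metric.tendsto_atTop]
  intro ε hε
  have hδ : 0 < (1 - |c|) * (ε / 2) := mul_pos (sub_pos.2 hc) (half_pos hε)
  obtain ⟨N, hN⟩ := Metric.tendsto_atTop.1 he _ hδ
  have bound : ∀ j, |x (N + j)| ≤ |c| ^ j * |x N| + ε / 2 := by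
    intro j
    induction j with
    | zero => simpa using (half_pos hε).le
    | succ j ih =>
      have hej : |e (N + j)| < (1 - |c|) * (ε / 2) := by
        simpa [Real.dist_eq] using hN (N + j) (Nat.le_add_right N j)
      calc |x (N + (j + 1))| = |c * x (N + j) + e (N + j)| := by rw [← add_assoc, hx]
        _ ≤ |c| * |x (N + j)| + |e (N + j)| := by
          rw [← abs_mul]; exact abs_add_le _ _
        _ ≤ |c| * (|c| ^ j * |x N| + ε / 2) + (1 - |c|) * (ε / 2) := by gcongr
        _ = |c| ^ (j + 1) * |x N| + ε / 2 := by ring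
  have hpow : Filter.Tendsto (fun j => |c| ^ j * |x N|) Filter.atTop (nhds 0) := by
    simpa using (tendsto_pow_atTop_nhds_zero_of_lt_one (abs_nonneg c) hc).mul_const |x N|
  obtain ⟨M, hM⟩ := Filter.eventually_atTop.1 (hpow.eventually_lt_const (half_pos hε))
  refine ⟨N + M, fun t ht => ?_⟩
  obtain ⟨j, rfl⟩ := Nat.exists_eq_add_of_le (le_of_add_le_left ht)
  rw [Real.dist_eq, sub_zero]
  linarith [bound j, hM j (by omega)]

/-- Let `0 < m < 2`, weights `w 0, …, w n > 0` with total `W`,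
bandwidth `B > 0`, and suppose the observed delay signal `D : ℕ → ℝ` satisfies
`T⁻¹ (D t) → B / W` (with `T⁻¹ (D t) > 0` for all `t`), where
`T⁻¹ D = α * exp (−(ln α − ln β) * (D − k) / p)`. If each flow's rate satisfies
`r i 0 > 0` and `r i (t+1) = r i t * (T⁻¹ (D t) / (r i t / w i)) ^ m`
(real power), then for every flow `i`, `r i t → (w i / W) * B`. -/
theorem stmt_12 (p k α β m : ℝ) (hp : 0 < p) (hβ : 0 < β) (hαβ : β < α)
    (hm0 : 0 < m) (hm2 : m < 2)
    (n : ℕ) (w : Fin (n + 1) → ℝ) (hw : ∀ i, 0 < w i)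
    (W : ℝ) (hW : W = ∑ i, w i) (B : ℝ) (hB : 0 < B)
    (Tinv : ℝ → ℝ)
    (hTinv : ∀ D, Tinv D = α * Real.exp (-(Real.log α - Real.log β) * (D - k) / p))
    (D : ℕ → ℝ) (hDpos : ∀ t, 0 < Tinv (D t))
    (hDlim : Filter.Tendsto (fun t => Tinv (D t)) Filter.atTop (nhds (B / W)))
    (r : Fin (n + 1) → ℕ → ℝ) (hr0 : ∀ i, 0 < r i 0)
    (hrec : ∀ i t, r i (t + 1) = r i t * (Tinv (D t) / (r i t / w i)) ^ m) :
    ∀ i, Filter.Tendsto (fun t => r i t) Filter.atTop (nhds ((w i / W) * B)) := by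
  intro i
  have hWpos : 0 < W := hW ▸ Finset.sum_pos (fun j _ => hw j) Finset.univ_nonempty
  have hL : 0 < B / W := div_pos hB hWpos
  have hr : ∀ t, 0 < r i t := by
    intro t
    induction t with
    | zero => exact hr0 i
    | succ t ih =>
      rw [hrec]
      exact mul_pos ih (Real.rpow_pos_of_pos (div_pos (hDpos t) (div_pos ih (hw i))) m)
  have he : Filter.Tendsto (fun t => m * (Real.log (Tinv (D t)) - Real.log (B / W)))
      Filter.atTop (nhds 0) := by
    simpa using ((hDlim.log hL.ne').sub_const (Real.log (B / W))).const_mul m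
  have hx : Filter.Tendsto (fun t => Real.log (r i t) - Real.log (w i) - Real.log (B / W))
      Filter.atTop (nhds 0) := by
    refine tendsto_zero_of_linear_recursion (c := 1 - m)
      (abs_lt.2 ⟨by linarith, by linarith⟩) he fun t => ?_
    have hq := div_pos (hr t) (hw i)
    have hu := div_pos (hDpos t) hq
    rw [hrec, Real.log_mul (hr t).ne' (Real.rpow_pos_of_pos hu m).ne', Real.log_rpow hu,
      Real.log_div (hDpos t).ne' hq.ne', Real.log_div (hr t).ne' (hw i).ne']
    ring
  have key := (hx.rexp).const_mul (w i / W * B)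
  rw [Real.exp_zero, mul_one] at key
  refine key.congr fun t => ?_
  rw [Real.exp_sub, Real.exp_sub, Real.exp_log (hr t), Real.exp_log (hw i), Real.exp_log hL]
  have := (hw i).ne'
  field_simp
end

section
/- Let m ≠ 0, Δt > 0, W > 0, B > 0. Define the joint fair-system map Φ on (0, ∞) × ℝ by Φ(x, D) = (x', D') where x' = x · (T⁻¹(D) / x)^m and D' = D + Δt · (W · x' − B) / B. Then Φ has exactly one fixed point, namely (x, D) = (B / W, T(B / W)) (assuming B / W > 0 lies in the domain of T). -/
/-- Let `m ≠ 0`, `Δt > 0`, `W > 0`, `B > 0`. The joint fair-system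
map `Φ (x, D) = (x', D')` with `x' = x * (T⁻¹ D / x) ^ m` (real power) and
`D' = D + Δt * (W * x' − B) / B`, defined on `(0, ∞) × ℝ`, has exactly one fixed
point, namely `(x, D) = (B / W, T (B / W))` (note `B / W > 0` is in the domain
of `T`). -/
theorem stmt_13 (p k α β m Δt W B : ℝ) (hp : 0 < p) (hβ : 0 < β) (hαβ : β < α)
    (hm : m ≠ 0) (hΔt : 0 < Δt) (hW : 0 < W) (hB : 0 < B)
    (T Tinv : ℝ → ℝ)
    (hT : ∀ x, T x = p * (Real.log α - Real.log x) / (Real.log α - Real.log β) + k)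
    (hTinv : ∀ D, Tinv D = α * Real.exp (-(Real.log α - Real.log β) * (D - k) / p))
    (Φ : ℝ × ℝ → ℝ × ℝ)
    (hΦ : ∀ x D : ℝ, Φ (x, D) =
      (x * (Tinv D / x) ^ m,
       D + Δt * (W * (x * (Tinv D / x) ^ m) - B) / B)) :
    ∀ x D : ℝ, 0 < x → (Φ (x, D) = (x, D) ↔ (x = B / W ∧ D = T (B / W))) := by
  have hα : 0 < α := hβ.trans hαβ
  have hL : 0 < Real.log α - Real.log β := sub_pos.2 (Real.log_lt_log hβ hαβ)
  have hTinv_pos : ∀ D, 0 < Tinv D := fun D => by rw [hTinv]; positivity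
  have hTinv_eq : ∀ x D, 0 < x → (Tinv D = x ↔ D = T x) := by
    intro x D hx
    have hlog : Real.log (Tinv D) =
        Real.log α + -(Real.log α - Real.log β) * (D - k) / p := by
      rw [hTinv, Real.log_mul hα.ne' (Real.exp_ne_zero _), Real.log_exp]
    rw [← Real.log_injOn_pos.eq_iff (hTinv_pos D) hx, hlog, hT,
      ← sub_eq_iff_eq_add, eq_div_iff hL.ne', ← eq_sub_iff_add_eq', div_eq_iff hp.ne']
    constructor <;> intro h <;> linarith
  have hrate : ∀ x D, 0 < x → (x * (Tinv D / x) ^ m = x ↔ D = T x) := by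
    intro x D hx
    have hq : 0 < Tinv D / x := div_pos (hTinv_pos D) hx
    rw [mul_eq_left₀ hx.ne', ← Real.one_rpow m, Real.rpow_left_inj hq.le zero_le_one hm, div_eq_one_iff_eq hx.ne',
      hTinv_eq x D hx]
  intro x D hx
  rw [hΦ, Prod.mk.injEq]
  constructor
  · rintro ⟨h₁, h₂⟩
    rw [h₁, add_eq_left, div_eq_zero_iff, or_iff_left hB.ne', mul_eq_zero,
      or_iff_right hΔt.ne', sub_eq_zero] at h₂
    have hxB : x = B / W := by rw [eq_div_iff hW.ne', mul_comm, h₂]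
    exact ⟨hxB, hxB ▸ (hrate x D hx).1 h₁⟩
  · rintro ⟨rfl, hD⟩
    have h₁ := (hrate _ D hx).2 hD
    refine ⟨h₁, ?_⟩
    rw [h₁, mul_div_cancel₀ B hW.ne', sub_self, mul_zero, zero_div, add_zero]
end

section
/- Let Δt > 0, W > 0, B > 0, and define F : ℝ → ℝ by F(D) = D + Δt · (W · T⁻¹(D) − B) / B, the one-round queue-delay map when m = 1 and all flows share the common rate-per-weight T⁻¹(D). Let D* = T(B / W). Then F(D*) = D*, F is differentiable, and F′(D*) = 1 − (Δt / p) · (ln α − ln β). -/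
/-- Let `Δt > 0`, `W > 0`, `B > 0`, and define
`F D = D + Δt * (W * T⁻¹ D − B) / B`, the one-round queue-delay map (smoother
`m = 1`, all flows at the common rate-per-weight `T⁻¹ D`). With
`D* = T (B / W)`: `F D* = D*`, `F` is differentiable, and
`F′ D* = 1 − (Δt / p) * (ln α − ln β)`. -/
theorem stmt_14 (p k α β Δt W B : ℝ) (hp : 0 < p) (hβ : 0 < β) (hαβ : β < α)
    (hΔt : 0 < Δt) (hW : 0 < W) (hB : 0 < B)
    (T Tinv : ℝ → ℝ)
    (hT : ∀ x, T x = p * (Real.log α - Real.log x) / (Real.log α - Real.log β) + k)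
    (hTinv : ∀ D, Tinv D = α * Real.exp (-(Real.log α - Real.log β) * (D - k) / p))
    (F : ℝ → ℝ) (hF : ∀ D, F D = D + Δt * (W * Tinv D - B) / B) :
    F (T (B / W)) = T (B / W) ∧ Differentiable ℝ F ∧
      deriv F (T (B / W)) = 1 - (Δt / p) * (Real.log α - Real.log β) := by
  have hL : 0 < Real.log α - Real.log β := sub_pos.2 (Real.log_lt_log hβ hαβ)
  have hα : 0 < α := hβ.trans hαβ
  have hx : 0 < B / W := div_pos hB hW
  have hinv : Tinv (T (B / W)) = B / W := by
    have hexp : -(Real.log α - Real.log β) * (T (B / W) - k) / p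
        = Real.log (B / W) - Real.log α := by
      rw [hT]
      field_simp
      ring
    rw [hTinv, hexp, Real.exp_sub, Real.exp_log hx, Real.exp_log hα]
    field_simp
  have hTinv' (D : ℝ) :
      HasDerivAt Tinv (Tinv D * (-(Real.log α - Real.log β) / p)) D := by
    have h := (((((hasDerivAt_id D).sub_const k).const_mul
      (-(Real.log α - Real.log β))).div_const p).exp).const_mul α
    rw [funext hTinv]
    refine h.congr_deriv ?_
    simp only [id]
    ring
  have hF' (D : ℝ) :
      HasDerivAt F (1 + Δt * (W * (Tinv D * (-(Real.log α - Real.log β) / p))) / B) D := by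
    rw [funext hF]
    exact (hasDerivAt_id D).add
      (((((hTinv' D).const_mul W).sub_const B).const_mul Δt).div_const B)
  refine ⟨?_, fun D => (hF' D).differentiableAt, ?_⟩
  · rw [hF, hinv]
    field_simp
    ring
  · rw [(hF' _).deriv, hinv]
    field_simp
    ring
end

section
/- Let Δt > 0, p > 0, α > β > 0, W > 0, B > 0, and let F(D) = D + Δt · (W · T⁻¹(D) − B) / B with fixed point D* = T(B / W). Then |F′(D*)| < 1 if and only if p > (Δt / 2) · (ln α − ln β). -/
/-- The map `D ↦ α * exp (-L * (D - k) / p)` inverts `x ↦ p * (log α - log x) / L + k` on the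
positive reals. -/
theorem mul_exp_target_eq {p k α L x : ℝ} (hp : p ≠ 0) (hα : 0 < α) (hL : L ≠ 0) (hx : 0 < x) :
    α * Real.exp (-L * (p * (Real.log α - Real.log x) / L + k - k) / p) = x := by
  have h : -L * (p * (Real.log α - Real.log x) / L + k - k) / p = Real.log x - Real.log α := by
    field_simp
    ring
  rw [h, Real.exp_sub, Real.exp_log hx, Real.exp_log hα]
  field_simp

theorem hasDerivAt_mul_exp_target (p k α L D : ℝ) :
    HasDerivAt (fun D => α * Real.exp (-L * (D - k) / p))
      (-(L / p) * (α * Real.exp (-L * (D - k) / p))) D := by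
  have h := (((((hasDerivAt_id D).sub_const k).const_mul (-L)).div_const p).exp).const_mul α
  refine h.congr_deriv ?_
  simp only [id]
  ring

/-- Let `Δt > 0`, `p > 0`, `α > β > 0`, `W > 0`, `B > 0`, and let
`F D = D + Δt * (W * T⁻¹ D − B) / B` with fixed point `D* = T (B / W)`. Then
`|F′ D*| < 1` iff `p > (Δt / 2) * (ln α − ln β)`. -/
theorem stmt_16 (p k α β Δt W B : ℝ) (hp : 0 < p) (hβ : 0 < β) (hαβ : β < α)
    (hΔt : 0 < Δt) (hW : 0 < W) (hB : 0 < B)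
    (T Tinv : ℝ → ℝ)
    (hT : ∀ x, T x = p * (Real.log α - Real.log x) / (Real.log α - Real.log β) + k)
    (hTinv : ∀ D, Tinv D = α * Real.exp (-(Real.log α - Real.log β) * (D - k) / p))
    (F : ℝ → ℝ) (hF : ∀ D, F D = D + Δt * (W * Tinv D - B) / B) :
    |deriv F (T (B / W))| < 1 ↔ p > (Δt / 2) * (Real.log α - Real.log β) := by
  have hL : 0 < Real.log α - Real.log β := sub_pos.mpr (Real.log_lt_log hβ hαβ)
  obtain rfl : Tinv = _ := funext hTinv
  obtain rfl : F = _ := funext hF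
  set L := Real.log α - Real.log β
  have hderiv : HasDerivAt
      (fun D => D + Δt * (W * (α * Real.exp (-L * (D - k) / p)) - B) / B)
      (1 - Δt * L / p) (T (B / W)) := by
    have h := (hasDerivAt_id (T (B / W))).add
      (((((hasDerivAt_mul_exp_target p k α L (T (B / W))).const_mul W).sub_const B).const_mul
        Δt).div_const B)
    refine h.congr_deriv ?_
    rw [hT, mul_exp_target_eq hp.ne' (hβ.trans hαβ) hL.ne' (div_pos hB hW)]
    field_simp
    ring
  have hpos : 0 < Δt * L / p := by positivity
  rw [hderiv.deriv, abs_lt]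
  calc -1 < 1 - Δt * L / p ∧ 1 - Δt * L / p < 1
      ↔ Δt * L / p < 2 := ⟨fun h => by linarith [h.1], fun h => ⟨by linarith, by linarith⟩⟩
    _ ↔ Δt * L < 2 * p := div_lt_iff₀ hp
    _ ↔ p > Δt / 2 * L := ⟨fun h => by linarith, fun h => by linarith⟩
end

section
/- Let m ∈ ℝ with m ≤ 0 or m ≥ 2, and let g : ℕ → ℝ be any positive signal. Then there exist sequences x, y : ℕ → ℝ with x(0) > 0, y(0) > 0, x(t+1) = x(t) · (g(t)/x(t))^m, y(t+1) = y(t) · (g(t)/y(t))^m, such that x(t)/y(t) does not converge to 1; in fact any initial values with x(0) ≠ y(0) have this property, since |ln(x(t)/y(t))| = |1 − m|^t · |ln(x(0)/y(0))| ≥ |ln(x(0)/y(0))| > 0 for all t. -/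
/-- The multiplicative update keeps every rate positive. -/
theorem rate_pos {m : ℝ} {g x : ℕ → ℝ} (hg : ∀ t, 0 < g t) (hx₀ : 0 < x 0)
    (hx : ∀ t, x (t + 1) = x t * (g t / x t) ^ m) (t : ℕ) : 0 < x t := by
  induction t with
  | zero => exact hx₀
  | succ t ih =>
    rw [hx]
    exact mul_pos ih (Real.rpow_pos_of_pos (div_pos (hg t) ih) m)

/-- In logarithmic coordinates the update is affine with slope `1 - m`. -/
theorem log_mul_div_rpow {a b : ℝ} (ha : 0 < a) (hb : 0 < b) (m : ℝ) :
    Real.log (b * (a / b) ^ m) = (1 - m) * Real.log b + m * Real.log a := by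
  have hab := div_pos ha hb
  rw [Real.log_mul hb.ne' (Real.rpow_pos_of_pos hab m).ne', Real.log_rpow hab,
    Real.log_div ha.ne' hb.ne']
  ring

/-- The logarithm of the ratio of two rates is scaled by `1 - m` in each round. -/
theorem log_rate_div {m : ℝ} {g x y : ℕ → ℝ} (hg : ∀ t, 0 < g t) (hx₀ : 0 < x 0) (hy₀ : 0 < y 0)
    (hx : ∀ t, x (t + 1) = x t * (g t / x t) ^ m)
    (hy : ∀ t, y (t + 1) = y t * (g t / y t) ^ m) (t : ℕ) :
    Real.log (x t / y t) = (1 - m) ^ t * Real.log (x 0 / y 0) := by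
  induction t with
  | zero => simp
  | succ t ih =>
    have hxt := rate_pos hg hx₀ hx
    have hyt := rate_pos hg hy₀ hy
    rw [pow_succ', mul_assoc, ← ih, Real.log_div (hxt _).ne' (hyt _).ne',
      Real.log_div (hxt _).ne' (hyt _).ne', hx, hy, log_mul_div_rpow (hg t) (hxt t),
      log_mul_div_rpow (hg t) (hyt t)]
    ring

/-- A sequence whose logarithm stays bounded away from `0` does not converge to `1`. -/
theorem not_tendsto_one_of_le_abs_log {u : ℕ → ℝ} {c : ℝ} (hc : 0 < c)
    (hu : ∀ t, c ≤ |Real.log (u t)|) : ¬ Filter.Tendsto u Filter.atTop (nhds 1) := by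
  intro h
  have hlog := (h.log one_ne_zero).abs
  rw [Real.log_one, abs_zero] at hlog
  exact hc.not_ge (ge_of_tendsto' hlog hu)

/-- Let `m ≤ 0` or `m ≥ 2`, and let `g : ℕ → ℝ` be any positive
signal. Then there exist sequences `x, y : ℕ → ℝ` with `x 0 > 0`, `y 0 > 0`,
`x (t+1) = x t * (g t / x t) ^ m`, `y (t+1) = y t * (g t / y t) ^ m`
(real powers), such that `x t / y t` does not converge to `1`; in fact any such
pair with `x 0 ≠ y 0` has this property, since
`|ln (x t / y t)| = |1 − m| ^ t * |ln (x 0 / y 0)| ≥ |ln (x 0 / y 0)| > 0`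
for all `t`. -/
theorem stmt_17 (m : ℝ) (hm : m ≤ 0 ∨ 2 ≤ m) (g : ℕ → ℝ) (hg : ∀ t, 0 < g t) :
    (∃ x y : ℕ → ℝ, 0 < x 0 ∧ 0 < y 0 ∧
      (∀ t, x (t + 1) = x t * (g t / x t) ^ m) ∧
      (∀ t, y (t + 1) = y t * (g t / y t) ^ m) ∧
      ¬ Filter.Tendsto (fun t => x t / y t) Filter.atTop (nhds 1)) ∧
    (∀ x y : ℕ → ℝ, 0 < x 0 → 0 < y 0 →
      (∀ t, x (t + 1) = x t * (g t / x t) ^ m) →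
      (∀ t, y (t + 1) = y t * (g t / y t) ^ m) →
      x 0 ≠ y 0 →
        (∀ t, |Real.log (x t / y t)| = |1 - m| ^ t * |Real.log (x 0 / y 0)|) ∧
        (∀ t, |Real.log (x 0 / y 0)| ≤ |Real.log (x t / y t)|) ∧
        0 < |Real.log (x 0 / y 0)| ∧
        ¬ Filter.Tendsto (fun t => x t / y t) Filter.atTop (nhds 1)) := by
  have key : ∀ x y : ℕ → ℝ, 0 < x 0 → 0 < y 0 →
      (∀ t, x (t + 1) = x t * (g t / x t) ^ m) →
      (∀ t, y (t + 1) = y t * (g t / y t) ^ m) →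
      x 0 ≠ y 0 →
        (∀ t, |Real.log (x t / y t)| = |1 - m| ^ t * |Real.log (x 0 / y 0)|) ∧
        (∀ t, |Real.log (x 0 / y 0)| ≤ |Real.log (x t / y t)|) ∧
        0 < |Real.log (x 0 / y 0)| ∧
        ¬ Filter.Tendsto (fun t => x t / y t) Filter.atTop (nhds 1) := by
    intro x y hx₀ hy₀ hx hy hne
    have habs (t : ℕ) : |Real.log (x t / y t)| = |1 - m| ^ t * |Real.log (x 0 / y 0)| := by
      rw [log_rate_div hg hx₀ hy₀ hx hy, abs_mul, abs_pow]
    have hm' : 1 ≤ |1 - m| := by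
      rw [le_abs]
      exact hm.imp (fun h => by linarith) (fun h => by linarith)
    have hle (t : ℕ) : |Real.log (x 0 / y 0)| ≤ |Real.log (x t / y t)| := by
      rw [habs t]
      exact le_mul_of_one_le_left (abs_nonneg _) (one_le_pow₀ hm')
    have hpos : 0 < |Real.log (x 0 / y 0)| := by
      refine abs_pos.mpr (Real.log_ne_zero_of_pos_of_ne_one (div_pos hx₀ hy₀) ?_)
      rwa [Ne, div_eq_one_iff_eq hy₀.ne']
    exact ⟨habs, hle, hpos, not_tendsto_one_of_le_abs_log hpos hle⟩
  refine ⟨?_, key⟩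
  let orbit (a : ℝ) (t : ℕ) : ℝ := Nat.rec a (fun t r => r * (g t / r) ^ m) t
  exact ⟨orbit 2, orbit 1, two_pos, one_pos, fun _ => rfl, fun _ => rfl,
    (key (orbit 2) (orbit 1) two_pos one_pos (fun _ => rfl) (fun _ => rfl)
      (OfNat.ofNat_ne_one 2)).2.2.2⟩
end
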